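/- arXiv:2312.15689 — 2 statements merged into one kernel-verified Lean document; each statement's English description precedes it below -/
import Mathlib

section
/- Let N ≥ 1 be an integer and let u ∈ L^1_0(ℝ^N). Then for every σ > 0 there exists a constant C_σ > 0 such that ∫_{ℝ^N} |w_u(x,t)| (1+|x|)^{−(N+σ)} dx ≤ C_σ (1 + max{−ln t, 0}) for every t > 0. -/
open MeasureTheory Real Filter Topology Set Metric

noncomputable section

/-- The normalization constant `c_N = Γ(N/2)/π^(N/2)`. -/
def cN (N : ℕ) : ℝ := Real.Gamma ((N : ℝ) / 2) / Real.pi ^ ((N : ℝ) / 2)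

/-- Membership in the space `L^1_0(ℝ^N)`. -/
def MemL10 (N : ℕ) (u : EuclideanSpace ℝ (Fin N) → ℝ) : Prop :=
  MeasureTheory.LocallyIntegrable u volume ∧
    MeasureTheory.Integrable (fun x => (1 + ‖x‖) ^ (-(N : ℝ)) * |u x|) volume

/-- The Poisson-type extension `w_u`. -/
def poissonExt (N : ℕ) (u : EuclideanSpace ℝ (Fin N) → ℝ)
    (x : EuclideanSpace ℝ (Fin N)) (t : ℝ) : ℝ :=
  (cN N / 2) * ∫ y, u y * (‖x - y‖ ^ 2 + t ^ 2) ^ (-(N : ℝ) / 2)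

lemma pow_mul_sq_add_sq_rpow_le {N : ℕ} (hN : 1 ≤ N) {y t : ℝ} (hy : 0 ≤ y) (ht : 0 < t) :
    y ^ (N - 1) * (y ^ 2 + t ^ 2) ^ (-(N : ℝ) / 2) ≤ 2 * (y + t)⁻¹ := by
  obtain ⟨n, rfl⟩ : ∃ n, N = n + 1 := ⟨N - 1, by omega⟩
  have hp : 0 < y ^ 2 + t ^ 2 := by positivity
  have hq : 0 < √(y ^ 2 + t ^ 2) := Real.sqrt_pos.2 hp
  have hyq : y ≤ √(y ^ 2 + t ^ 2) := Real.le_sqrt_of_sq_le (by nlinarith)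
  have htq : t ≤ √(y ^ 2 + t ^ 2) := Real.le_sqrt_of_sq_le (by nlinarith)
  have e : (y ^ 2 + t ^ 2) ^ (-((n + 1 : ℕ) : ℝ) / 2) = (√(y ^ 2 + t ^ 2) ^ (n + 1))⁻¹ := by
    rw [Real.sqrt_eq_rpow, ← Real.rpow_natCast (_ ^ (_ : ℝ)), ← Real.rpow_mul hp.le, ← Real.rpow_neg hp.le]
    congr 1
    ring
  rw [e]
  generalize √(y ^ 2 + t ^ 2) = q at *
  have h1 : y ^ n * (q ^ (n + 1))⁻¹ ≤ q⁻¹ := by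
    rw [mul_inv_le_iff₀ (by positivity), pow_succ']
    rw [inv_mul_cancel_left₀ hq.ne']
    gcongr
  calc _ ≤ q⁻¹ := by simpa using h1
    _ ≤ 2 * (y + t)⁻¹ := by
      rw [← div_eq_mul_inv, inv_eq_one_div, div_le_div_iff₀ hq (by positivity)]
      linarith

lemma continuous_sq_add_sq_rpow {t : ℝ} (ht : 0 < t) (a : ℝ) :
    Continuous fun y : ℝ => (y ^ 2 + t ^ 2) ^ a :=
  Continuous.rpow_const (by fun_prop) fun y => Or.inl (by positivity)

lemma integrable_indicator_sq_norm_add_sq_rpow (N : ℕ) {t : ℝ} (ht : 0 < t) (S a : ℝ) :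
    Integrable (fun z : EuclideanSpace ℝ (Fin N) =>
      (Iio S).indicator (fun r => (r ^ 2 + t ^ 2) ^ a) ‖z‖) volume := by
  have hc : Continuous fun z : EuclideanSpace ℝ (Fin N) => (‖z‖ ^ 2 + t ^ 2) ^ a :=
    (continuous_sq_add_sq_rpow ht a).comp continuous_norm
  have h := ((hc.continuousOn (s := closedBall 0 S)).integrableOn_compact
    (μ := volume) (isCompact_closedBall 0 S)).mono_set (ball_subset_closedBall)
  rw [← integrable_indicator_iff measurableSet_ball] at h
  refine h.congr (Eventually.of_forall fun z => ?_)
  simp [indicator]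

/-- The logarithmic bound for the mass of the extension kernel on a ball. -/
lemma integral_indicator_sq_norm_add_sq_rpow_le {N : ℕ} (hN : 1 ≤ N) {t S : ℝ} (ht : 0 < t)
    (hS : 0 < S) :
    ∫ z : EuclideanSpace ℝ (Fin N),
        (Iio S).indicator (fun r => (r ^ 2 + t ^ 2) ^ (-(N : ℝ) / 2)) ‖z‖
      ≤ 2 * N * volume.real (ball (0 : EuclideanSpace ℝ (Fin N)) 1) * Real.log (1 + S / t) := by
  have key : ∫ y in Ioi (0 : ℝ), y ^ (N - 1) •
      (Iio S).indicator (fun r => (r ^ 2 + t ^ 2) ^ (-(N : ℝ) / 2)) y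
        ≤ 2 * Real.log (1 + S / t) := by
    have e (y : ℝ) : y ^ (N - 1) • (Iio S).indicator (fun r => (r ^ 2 + t ^ 2) ^ (-(N : ℝ) / 2)) y
        = (Iio S).indicator (fun r => r ^ (N - 1) * (r ^ 2 + t ^ 2) ^ (-(N : ℝ) / 2)) y := by
      simp [indicator]
    simp_rw [e]
    rw [setIntegral_indicator measurableSet_Iio, Ioi_inter_Iio]
    have hc := continuous_sq_add_sq_rpow ht (-(N : ℝ) / 2)
    have i1 : IntegrableOn (fun r : ℝ => r ^ (N - 1) * (r ^ 2 + t ^ 2) ^ (-(N : ℝ) / 2))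
        (Ioo 0 S) volume :=
      ((by fun_prop : Continuous fun r : ℝ =>
        r ^ (N - 1) * (r ^ 2 + t ^ 2) ^ (-(N : ℝ) / 2)).continuousOn.integrableOn_compact
          isCompact_Icc).mono_set Ioo_subset_Icc_self
    have c2 : ContinuousOn (fun r : ℝ => 2 * (r + t)⁻¹) (Icc 0 S) := by
      refine continuousOn_const.mul (ContinuousOn.inv₀ (by fun_prop) fun r hr => ?_)
      have := hr.1
      positivity
    have i2 : IntegrableOn (fun r : ℝ => 2 * (r + t)⁻¹) (Ioo 0 S) volume :=
      (c2.integrableOn_compact isCompact_Icc).mono_set Ioo_subset_Icc_self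
    calc _ ≤ ∫ r in Ioo 0 S, 2 * (r + t)⁻¹ :=
          setIntegral_mono_on i1 i2 measurableSet_Ioo fun r hr =>
            pow_mul_sq_add_sq_rpow_le hN hr.1.le ht
      _ = 2 * Real.log (1 + S / t) := by
          rw [← integral_Ioc_eq_integral_Ioo, ← intervalIntegral.integral_of_le hS.le,
            intervalIntegral.integral_const_mul,
            intervalIntegral.integral_comp_add_right (fun r => r⁻¹),
            integral_inv_of_pos (by linarith) (by linarith)]
          congr 2
          field_simp
          ring
  have : NeZero N := ⟨by omega⟩
  rw [integral_fun_norm_addHaar volume, finrank_euclideanSpace_fin, nsmul_eq_mul, smul_eq_mul]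
  calc _ ≤ (N : ℝ) * (volume.real (ball (0 : EuclideanSpace ℝ (Fin N)) 1)
        * (2 * Real.log (1 + S / t))) := by gcongr
    _ = _ := by ring

lemma log_one_add_div_le {S t : ℝ} (hS : 1 ≤ S) (ht : 0 < t) :
    Real.log (1 + S / t) ≤ Real.log S + Real.log 2 + max (-Real.log t) 0 := by
  have hm : 0 < max t⁻¹ 1 := by positivity
  have h : 1 + S / t ≤ S * 2 * max t⁻¹ 1 := by
    have h1 : S * t⁻¹ ≤ S * max t⁻¹ 1 := by gcongr; exact le_max_left _ _
    have h2 : 1 * 1 ≤ S * max t⁻¹ 1 := by gcongr; exact le_max_right _ _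
    rw [div_eq_mul_inv]
    linarith
  calc _ ≤ Real.log (S * 2 * max t⁻¹ 1) := Real.log_le_log (by positivity) h
    _ = Real.log S + Real.log 2 + Real.log (max t⁻¹ 1) := by
      rw [Real.log_mul (by positivity) hm.ne', Real.log_mul (by positivity) (by norm_num)]
    _ ≤ _ := by
      gcongr
      rcases max_cases t⁻¹ 1 with ⟨h, _⟩ | ⟨h, _⟩ <;> rw [h]
      · rw [Real.log_inv]; exact le_max_left _ _
      · simp

/-- Near the diagonal the weight is controlled by the decay in `y`, away from it the kernel is. -/
lemma kernel_mul_weight_le {N : ℕ} {σ t : ℝ} (hσ : 0 < σ) (x y : EuclideanSpace ℝ (Fin N)) :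
    (‖x - y‖ ^ 2 + t ^ 2) ^ (-(N : ℝ) / 2) * (1 + ‖x‖) ^ (-((N : ℝ) + σ))
      ≤ ((1 + ‖y‖) / 2) ^ (-(N : ℝ)) * (1 + ‖x‖) ^ (-((N : ℝ) + σ)) +
        ((1 + ‖y‖) / 2) ^ (-((N : ℝ) + σ)) *
          (Iio (1 + ‖y‖)).indicator (fun r => (r ^ 2 + t ^ 2) ^ (-(N : ℝ) / 2)) ‖x - y‖ := by
  have hS : 0 < (1 + ‖y‖) / 2 := by positivity
  have hN : (0 : ℝ) ≤ N := N.cast_nonneg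
  rcases le_or_gt ((1 + ‖y‖) / 2) ‖x - y‖ with h | h
  · refine le_add_of_le_of_nonneg ?_ (mul_nonneg (by positivity) (indicator_nonneg ?_ _))
    · gcongr
      calc _ ≤ (((1 + ‖y‖) / 2) ^ 2) ^ (-(N : ℝ) / 2) :=
            Real.rpow_le_rpow_of_nonpos (by positivity)
              (by nlinarith [sq_nonneg t]) (by linarith)
        _ = _ := by
            rw [← Real.rpow_natCast, ← Real.rpow_mul hS.le]
            congr 1
            push_cast
            ring
    · intro r _
      positivity
  · refine le_add_of_nonneg_of_le (by positivity) ?_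
    rw [indicator_of_mem (by rw [mem_Iio]; linarith), mul_comm]
    gcongr ?_ * _
    refine Real.rpow_le_rpow_of_nonpos hS ?_ (by linarith)
    have := norm_sub_norm_le y x
    rw [norm_sub_rev] at this
    linarith

lemma lintegral_kernel_mul_weight_le {N : ℕ} (hN : 1 ≤ N) {σ : ℝ} (hσ : 0 < σ) :
    ∃ A : ℝ, 0 ≤ A ∧ ∀ t : ℝ, 0 < t → ∀ y : EuclideanSpace ℝ (Fin N),
      ∫⁻ x, ENNReal.ofReal ((‖x - y‖ ^ 2 + t ^ 2) ^ (-(N : ℝ) / 2) *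
          (1 + ‖x‖) ^ (-((N : ℝ) + σ)))
        ≤ ENNReal.ofReal (A * (1 + max (-Real.log t) 0) * (1 + ‖y‖) ^ (-(N : ℝ))) := by
  have hw : Integrable (fun x : EuclideanSpace ℝ (Fin N) => (1 + ‖x‖) ^ (-((N : ℝ) + σ))) volume :=
    integrable_one_add_norm (by rw [finrank_euclideanSpace_fin]; linarith)
  set I := ∫ x : EuclideanSpace ℝ (Fin N), (1 + ‖x‖) ^ (-((N : ℝ) + σ)) with hI
  have hI0 : 0 ≤ I := integral_nonneg fun x => by positivity
  set V := volume.real (ball (0 : EuclideanSpace ℝ (Fin N)) 1)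
  have hV0 : 0 ≤ V := measureReal_nonneg
  refine ⟨2 ^ (N : ℝ) * I + 2 ^ ((N : ℝ) + σ) * (2 * N * V) * (1 / σ + 1), by positivity,
    fun t ht y => ?_⟩
  set S := 1 + ‖y‖ with hS
  have hS1 : 1 ≤ S := by simp [hS]
  have hS0 : 0 < S := by linarith
  set L := max (-Real.log t) 0
  have hL : 0 ≤ L := le_max_right _ _
  have hg := (integrable_indicator_sq_norm_add_sq_rpow N ht S (-(N : ℝ) / 2)).comp_sub_right y
  have hint := (hw.const_mul ((S / 2) ^ (-(N : ℝ)))).add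
    (hg.const_mul ((S / 2) ^ (-((N : ℝ) + σ))))
  refine (lintegral_mono fun x =>
    ENNReal.ofReal_le_ofReal (kernel_mul_weight_le hσ x y)).trans ?_
  refine (ofReal_integral_eq_lintegral_ofReal hint (Eventually.of_forall fun x =>
    le_trans (by positivity) (kernel_mul_weight_le (t := t) hσ x y))).symm.trans_le ?_
  apply ENNReal.ofReal_le_ofReal
  rw [integral_add' (hw.const_mul _) (hg.const_mul _), integral_const_mul, integral_const_mul,
    integral_sub_right_eq_self (fun x : EuclideanSpace ℝ (Fin N) =>
      (Iio S).indicator (fun r => (r ^ 2 + t ^ 2) ^ (-(N : ℝ) / 2)) ‖x‖) y, ← hI]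
  have hhalf (a : ℝ) : (S / 2) ^ (-a) = 2 ^ a * S ^ (-a) := by
    rw [Real.div_rpow hS0.le (by norm_num), Real.rpow_neg (by norm_num : (0 : ℝ) ≤ 2), div_inv_eq_mul,
      mul_comm]
  have hlog : Real.log (1 + S / t) ≤ S ^ σ * ((1 / σ + 1) * (1 + L)) := by
    have h1 := log_one_add_div_le hS1 ht
    have h2 := Real.log_le_rpow_div hS0.le hσ
    have h3 : 1 ≤ S ^ σ := Real.one_le_rpow hS1 hσ.le
    have h4 : Real.log 2 ≤ 1 := by linarith [Real.log_two_lt_d9]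
    have h5 : 1 * (1 + L) ≤ S ^ σ * (1 + L) := by gcongr
    have h6 : 0 ≤ S ^ σ * (1 / σ) * L := by positivity
    calc _ ≤ S ^ σ / σ + (1 + L) := by linarith
      _ ≤ S ^ σ / σ + S ^ σ * (1 + L) + S ^ σ * (1 / σ) * L := by linarith
      _ = _ := by ring
  have hSσ : S ^ (-((N : ℝ) + σ)) * S ^ σ = S ^ (-(N : ℝ)) := by
    rw [← Real.rpow_add hS0]
    congr 1
    ring
  calc _ ≤ (S / 2) ^ (-(N : ℝ)) * I + (S / 2) ^ (-((N : ℝ) + σ)) *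
        (2 * N * V * (S ^ σ * ((1 / σ + 1) * (1 + L)))) := by
        gcongr
        exact (integral_indicator_sq_norm_add_sq_rpow_le hN ht hS0).trans (by gcongr)
    _ = 2 ^ (N : ℝ) * I * S ^ (-(N : ℝ)) * 1 + 2 ^ ((N : ℝ) + σ) * (2 * N * V) * (1 / σ + 1) *
        (1 + L) * (S ^ (-((N : ℝ) + σ)) * S ^ σ) := by
        rw [hhalf, hhalf]
        ring
    _ ≤ 2 ^ (N : ℝ) * I * S ^ (-(N : ℝ)) * (1 + L) +
        2 ^ ((N : ℝ) + σ) * (2 * N * V) * (1 / σ + 1) *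
        (1 + L) * (S ^ (-((N : ℝ) + σ)) * S ^ σ) := by
        gcongr
        linarith
    _ = _ := by
        rw [hSσ]
        ring

/-- weighted `L¹` bound `∫ |w_u(x,t)| (1+|x|)^{-(N+σ)} dx ≤ C_σ (1 + ln⁻ t)`. -/
theorem stmt4 (N : ℕ) (hN : 1 ≤ N) (u : EuclideanSpace ℝ (Fin N) → ℝ)
    (hu : MemL10 N u) :
    ∀ σ : ℝ, 0 < σ → ∃ C : ℝ, 0 < C ∧
      ∀ t : ℝ, 0 < t →
        (∫ x, |poissonExt N u x t| * (1 + ‖x‖) ^ (-((N : ℝ) + σ)))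
          ≤ C * (1 + max (-Real.log t) 0) := by
  intro σ hσ
  obtain ⟨A, hA0, hA⟩ := lintegral_kernel_mul_weight_le hN hσ
  obtain ⟨hloc, hM⟩ := hu
  have hmeas : AEMeasurable u volume := hloc.aestronglyMeasurable.aemeasurable
  set M := ∫ y, (1 + ‖y‖) ^ (-(N : ℝ)) * |u y| with hMdef
  have hM0 : 0 ≤ M := integral_nonneg fun y => by positivity
  refine ⟨|cN N / 2| * (A * M) + 1, by positivity, fun t ht => ?_⟩
  set L := max (-Real.log t) 0
  have hL : 0 ≤ L := le_max_right _ _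
  suffices h : ∫⁻ x, ‖|poissonExt N u x t| * (1 + ‖x‖) ^ (-((N : ℝ) + σ))‖ₑ
      ≤ ENNReal.ofReal (|cN N / 2| * (A * (1 + L) * M)) by
    have h1 := (enorm_integral_le_lintegral_enorm _).trans h
    rw [Real.enorm_eq_ofReal_abs, ENNReal.ofReal_le_ofReal_iff (by positivity)] at h1
    refine (le_abs_self _).trans (h1.trans ?_)
    nlinarith
  have hk (x y : EuclideanSpace ℝ (Fin N)) : 0 ≤ (‖x - y‖ ^ 2 + t ^ 2) ^ (-(N : ℝ) / 2) := by
    positivity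
  have hkm : Measurable fun p : EuclideanSpace ℝ (Fin N) × EuclideanSpace ℝ (Fin N) =>
      ENNReal.ofReal ((‖p.1 - p.2‖ ^ 2 + t ^ 2) ^ (-(N : ℝ) / 2) *
        (1 + ‖p.1‖) ^ (-((N : ℝ) + σ))) := by
    fun_prop
  have hpt (x : EuclideanSpace ℝ (Fin N)) :
      ‖|poissonExt N u x t| * (1 + ‖x‖) ^ (-((N : ℝ) + σ))‖ₑ ≤
        ENNReal.ofReal |cN N / 2| * ∫⁻ y, ‖u y‖ₑ *
          ENNReal.ofReal ((‖x - y‖ ^ 2 + t ^ 2) ^ (-(N : ℝ) / 2) *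
            (1 + ‖x‖) ^ (-((N : ℝ) + σ))) := by
    have e : ∫⁻ y, ‖u y‖ₑ * ENNReal.ofReal ((‖x - y‖ ^ 2 + t ^ 2) ^ (-(N : ℝ) / 2) *
            (1 + ‖x‖) ^ (-((N : ℝ) + σ))) =
        (∫⁻ y, ‖u y * (‖x - y‖ ^ 2 + t ^ 2) ^ (-(N : ℝ) / 2)‖ₑ) *
          ENNReal.ofReal ((1 + ‖x‖) ^ (-((N : ℝ) + σ))) := by
      rw [← lintegral_mul_const' _ _ ENNReal.ofReal_ne_top]
      refine lintegral_congr fun y => ?_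
      rw [enorm_mul, Real.enorm_of_nonneg (hk x y), ENNReal.ofReal_mul (hk x y), mul_assoc]
    rw [e, enorm_mul, Real.enorm_abs, poissonExt, enorm_mul, Real.enorm_eq_ofReal_abs (cN N / 2),
      Real.enorm_of_nonneg (by positivity : 0 ≤ (1 + ‖x‖) ^ (-((N : ℝ) + σ))), mul_assoc]
    gcongr
    exact enorm_integral_le_lintegral_enorm _
  calc _ ≤ ∫⁻ x, ENNReal.ofReal |cN N / 2| * ∫⁻ y, ‖u y‖ₑ *
          ENNReal.ofReal ((‖x - y‖ ^ 2 + t ^ 2) ^ (-(N : ℝ) / 2) *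
            (1 + ‖x‖) ^ (-((N : ℝ) + σ))) := lintegral_mono hpt
    _ = ENNReal.ofReal |cN N / 2| * ∫⁻ y, ‖u y‖ₑ *
          ∫⁻ x, ENNReal.ofReal ((‖x - y‖ ^ 2 + t ^ 2) ^ (-(N : ℝ) / 2) *
            (1 + ‖x‖) ^ (-((N : ℝ) + σ))) := by
        rw [lintegral_const_mul' _ _ ENNReal.ofReal_ne_top, lintegral_lintegral_swap]
        · congr 1
          exact lintegral_congr fun y => lintegral_const_mul' _ _ enorm_ne_top
        · exact hmeas.enorm.comp_snd.mul hkm.aemeasurable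
    _ ≤ ENNReal.ofReal |cN N / 2| * ∫⁻ y, ENNReal.ofReal (A * (1 + L)) *
          ENNReal.ofReal ((1 + ‖y‖) ^ (-(N : ℝ)) * |u y|) := by
        refine mul_le_mul_right (lintegral_mono fun y => ?_) _
        refine (mul_le_mul_right (hA t ht y) _).trans_eq ?_
        rw [Real.enorm_eq_ofReal_abs, ← ENNReal.ofReal_mul (abs_nonneg _),
          ← ENNReal.ofReal_mul (by positivity)]
        congr 1
        ring
    _ = _ := by
        rw [lintegral_const_mul' _ _ ENNReal.ofReal_ne_top,
          ← ofReal_integral_eq_lintegral_ofReal hM (Eventually.of_forall fun y => by positivity),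
          ← ENNReal.ofReal_mul (by positivity), ← ENNReal.ofReal_mul (by positivity)]
end
end

section
/- Let N ≥ 1 be an integer and let u ∈ L^1_0(ℝ^N). Extend w_u evenly in the t-variable, i.e. consider (x,t) ↦ w_u(x,|t|) on ℝ^{N+1}. Then for every test function φ ∈ C_c^∞(ℝ^{N+1}), ∫_{ℝ^{N+1}} w_u(x,|t|) · div(|t| ∇φ(x,t)) dx dt = −2 ∫_{ℝ^N} u(x) φ(x,0) dx; that is, the even extension solves −div(|t| ∇w) = 2 u ℒ^N ⊗ δ_0 in ℝ^{N+1} in the distributional sense. -/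
open MeasureTheory Real Filter Topology Set Metric

noncomputable section

/-- The sign of `t`, with the value `-1` at `0`. -/
def halfSign (t : ℝ) : ℝ := if 0 < t then 1 else -1

lemma measurable_halfSign : Measurable halfSign :=
  Measurable.ite measurableSet_Ioi measurable_const measurable_const

lemma abs_halfSign (t : ℝ) : |halfSign t| = 1 := by
  unfold halfSign; split_ifs <;> simp

lemma halfSign_mul_self (t : ℝ) : halfSign t * t = |t| := by
  unfold halfSign
  split_ifs with h
  · rw [abs_of_pos h, one_mul]
  · rw [abs_of_nonpos (not_lt.1 h), neg_one_mul]

/-- The derivative of `f` in the constant direction `v`. -/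
def dirDeriv {F : Type*} [NormedAddCommGroup F] [NormedSpace ℝ F] (v : F) (f : F → ℝ) (p : F) : ℝ :=
  fderiv ℝ f p v

section dirDeriv

variable {F : Type*} [NormedAddCommGroup F] [NormedSpace ℝ F] {f' : F →L[ℝ] ℝ}
  {f g : F → ℝ} {v p : F}

lemma contDiff_dirDeriv (hf : ContDiff ℝ (⊤ : ℕ∞) f) (v : F) :
    ContDiff ℝ (⊤ : ℕ∞) (dirDeriv v f) :=
  (hf.fderiv_right (m := (⊤ : ℕ∞)) le_rfl).clm_apply contDiff_const

lemma hasCompactSupport_dirDeriv (hf : HasCompactSupport f) (v : F) :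
    HasCompactSupport (dirDeriv v f) :=
  hf.fderiv_apply (𝕜 := ℝ) v

lemma dirDeriv_eq (h : HasFDerivAt f f' p) : dirDeriv v f p = f' v := by
  rw [dirDeriv, h.fderiv]

lemma dirDeriv_mul (hf : DifferentiableAt ℝ f p) (hg : DifferentiableAt ℝ g p) :
    dirDeriv v (fun q => f q * g q) p = f p * dirDeriv v g p + dirDeriv v f p * g p := by
  rw [dirDeriv_eq (hf.hasFDerivAt.fun_mul hg.hasFDerivAt)]
  simp [dirDeriv, mul_comm]

lemma dirDeriv_sub (hf : DifferentiableAt ℝ f p) (hg : DifferentiableAt ℝ g p) :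
    dirDeriv v (fun q => f q - g q) p = dirDeriv v f p - dirDeriv v g p := by
  rw [dirDeriv_eq (hf.hasFDerivAt.fun_sub hg.hasFDerivAt)]
  simp [dirDeriv]

end dirDeriv

instance (N : ℕ) : (volume : Measure (EuclideanSpace ℝ (Fin N) × ℝ)).IsAddHaarMeasure :=
  Measure.prod.instIsAddHaarMeasure _ _

/-- The `i`-th horizontal coordinate direction of `ℝ^N × ℝ`. -/
def horizDir {N : ℕ} (i : Fin N) : EuclideanSpace ℝ (Fin N) × ℝ :=
  (EuclideanSpace.single i 1, 0)

/-- The operator `t Δ f + ∂_t f`, which is `div(|t| ∇f)` up to the sign of `t`. -/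
def weightedLap {N : ℕ} (f : EuclideanSpace ℝ (Fin N) × ℝ → ℝ)
    (p : EuclideanSpace ℝ (Fin N) × ℝ) : ℝ :=
  p.2 * (∑ i : Fin N, dirDeriv (horizDir i) (dirDeriv (horizDir i) f) p
    + dirDeriv (0, 1) (dirDeriv (0, 1) f) p) + dirDeriv (0, 1) f p

section Green

variable {N : ℕ} {f g : EuclideanSpace ℝ (Fin N) × ℝ → ℝ}

lemma continuous_weightedLap (hf : ContDiff ℝ (⊤ : ℕ∞) f) :
    Continuous (weightedLap f) := by
  have h1 : ∀ v, Continuous (dirDeriv v f) := fun v => (contDiff_dirDeriv hf v).continuous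
  have h2 : ∀ v, Continuous (dirDeriv v (dirDeriv v f)) :=
    fun v => (contDiff_dirDeriv (contDiff_dirDeriv hf v) v).continuous
  unfold weightedLap
  fun_prop

lemma hasCompactSupport_weightedLap (hf : HasCompactSupport f) :
    HasCompactSupport (weightedLap f) := by
  refine HasCompactSupport.intro' (K := tsupport f) hf (isClosed_tsupport f) fun p hp => ?_
  have h1 : ∀ (h : EuclideanSpace ℝ (Fin N) × ℝ → ℝ) v,
      tsupport (dirDeriv v h) ⊆ tsupport h := fun h v => tsupport_fderiv_apply_subset ℝ v
  have h2 : ∀ v, dirDeriv v f p = 0 := fun v =>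
    image_eq_zero_of_notMem_tsupport fun h => hp (h1 _ _ h)
  have h3 : ∀ v, dirDeriv v (dirDeriv v f) p = 0 := fun v =>
    image_eq_zero_of_notMem_tsupport fun h => hp (h1 _ _ (h1 _ _ h))
  simp [weightedLap, h2, h3]

lemma integrable_halfSign_mul (hf : Integrable f) :
    Integrable fun p => halfSign p.2 * f p :=
  hf.bdd_mul (c := 1) (measurable_halfSign.comp measurable_snd).aestronglyMeasurable
    (Eventually.of_forall fun p => (abs_halfSign p.2).le)

lemma integral_abs_mul_dirDeriv_horiz (hf : ContDiff ℝ (⊤ : ℕ∞) f) (hfc : HasCompactSupport f)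
    (x : EuclideanSpace ℝ (Fin N)) :
    ∫ p, |p.2| * dirDeriv (x, 0) f p = 0 := by
  have key := integral_bilinear_hasLineDerivAt_right_eq_neg_left_of_integrable
    (μ := (volume : Measure (EuclideanSpace ℝ (Fin N) × ℝ)))
    (f := fun p => |p.2|) (f' := fun _ => (0 : ℝ)) (g := f) (g' := dirDeriv (x, 0) f)
    (v := (x, 0)) (B := ContinuousLinearMap.mul ℝ ℝ) (by simp)
    (((continuous_abs.comp continuous_snd).mul
      (contDiff_dirDeriv hf _).continuous).integrable_of_hasCompactSupport
      (hasCompactSupport_dirDeriv hfc _).mul_left)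
    (((continuous_abs.comp continuous_snd).mul hf.continuous).integrable_of_hasCompactSupport
      hfc.mul_left)
    (fun p _ => by simpa [HasLineDerivAt] using hasDerivAt_const (0 : ℝ) |p.2|)
    (fun p _ => ((hf.differentiable (by simp)) p).hasFDerivAt.hasLineDerivAt _)
  simpa using key

lemma integral_halfSign_mul_dirDeriv_vert (hf : ContDiff ℝ (⊤ : ℕ∞) f)
    (hfc : HasCompactSupport f) (hf0 : ∀ x, f (x, 0) = 0) :
    ∫ p, halfSign p.2 * dirDeriv (0, 1) f p = 0 := by
  have hint : Integrable (dirDeriv (0, 1) f) :=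
    (contDiff_dirDeriv hf _).continuous.integrable_of_hasCompactSupport
      (hasCompactSupport_dirDeriv hfc _)
  rw [Measure.volume_eq_prod, integral_prod _ (integrable_halfSign_mul hint)]
  refine integral_eq_zero_of_ae (Eventually.of_forall fun x => ?_)
  have hslice : ContDiff ℝ 1 fun t : ℝ => f (x, t) :=
    (hf.of_le (by simp)).comp (contDiff_const.prodMk contDiff_id)
  have hemb : IsClosedEmbedding fun t : ℝ => (x, t) :=
    ⟨isEmbedding_prodMkRight x, by
      have : range (fun t : ℝ => (x, t)) = Prod.fst ⁻¹' {x} := by ext ⟨a, b⟩; simp [eq_comm]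
      rw [this]; exact isClosed_singleton.preimage continuous_fst⟩
  have hcs : HasCompactSupport fun t : ℝ => f (x, t) := hfc.comp_isClosedEmbedding hemb
  have hd : ∀ t, dirDeriv (0, 1) f (x, t) = deriv (fun t => f (x, t)) t := fun t => by
    have h1 := ((hf.differentiable (by simp)) (x, t)).hasFDerivAt
    have h2 : HasDerivAt (fun t : ℝ => (x, t)) (0, 1) t :=
      (hasDerivAt_const t x).prodMk (hasDerivAt_id t)
    exact (h1.comp_hasDerivAt t h2).deriv.symm
  have hi : Integrable (fun t => halfSign t * deriv (fun t => f (x, t)) t) :=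
    ((hslice.continuous_deriv le_rfl).integrable_of_hasCompactSupport hcs.deriv).bdd_mul (c := 1)
      measurable_halfSign.aestronglyMeasurable
      (Eventually.of_forall fun p => (abs_halfSign p).le)
  simp only [hd, Pi.zero_apply]
  rw [← integral_add_compl (measurableSet_Iic (a := (0 : ℝ))) hi, compl_Iic,
    setIntegral_congr_fun (g := fun t => -1 * deriv (fun t => f (x, t)) t) measurableSet_Iic,
    setIntegral_congr_fun (s := Ioi 0) (g := fun t => deriv (fun t => f (x, t)) t) measurableSet_Ioi,
    integral_const_mul, hcs.integral_Iic_deriv_eq hslice, hcs.integral_Ioi_deriv_eq hslice]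
  · simp [hf0]
  · intro t ht; simp [halfSign, mem_Ioi.1 ht]
  · intro t ht; simp [halfSign, mem_Iic.1 ht]

/-- The Green flux density of `f` and `g` in the direction `v`. -/
def greenFlux (f g : EuclideanSpace ℝ (Fin N) × ℝ → ℝ) (v p : EuclideanSpace ℝ (Fin N) × ℝ) : ℝ :=
  f p * dirDeriv v g p - g p * dirDeriv v f p

lemma contDiff_greenFlux (hf : ContDiff ℝ (⊤ : ℕ∞) f) (hg : ContDiff ℝ (⊤ : ℕ∞) g) (v) :
    ContDiff ℝ (⊤ : ℕ∞) (greenFlux f g v) :=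
  (hf.mul (contDiff_dirDeriv hg v)).sub (hg.mul (contDiff_dirDeriv hf v))

lemma hasCompactSupport_greenFlux (hg : HasCompactSupport g) (v) :
    HasCompactSupport (greenFlux f g v) :=
  (hasCompactSupport_dirDeriv hg v).mul_left.sub hg.mul_right

lemma dirDeriv_greenFlux (hf : ContDiff ℝ (⊤ : ℕ∞) f) (hg : ContDiff ℝ (⊤ : ℕ∞) g) (v p) :
    dirDeriv v (greenFlux f g v) p
      = f p * dirDeriv v (dirDeriv v g) p - g p * dirDeriv v (dirDeriv v f) p := by
  have h : ∀ {f : EuclideanSpace ℝ (Fin N) × ℝ → ℝ}, ContDiff ℝ (⊤ : ℕ∞) f →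
      DifferentiableAt ℝ f p := fun hf => hf.differentiable (by simp) p
  unfold greenFlux
  rw [dirDeriv_sub (h (hf.mul (contDiff_dirDeriv hg v))) (h (hg.mul (contDiff_dirDeriv hf v))),
    dirDeriv_mul (h hf) (h (contDiff_dirDeriv hg v)),
    dirDeriv_mul (h hg) (h (contDiff_dirDeriv hf v))]
  ring

lemma weightedLap_green (hf : ContDiff ℝ (⊤ : ℕ∞) f) (hg : ContDiff ℝ (⊤ : ℕ∞) g)
    (p : EuclideanSpace ℝ (Fin N) × ℝ) :
    halfSign p.2 * (f p * weightedLap g p) - halfSign p.2 * (g p * weightedLap f p)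
      = ∑ i : Fin N, |p.2| * dirDeriv (horizDir i) (greenFlux f g (horizDir i)) p
        + halfSign p.2 * dirDeriv (0, 1) (fun q => q.2 * greenFlux f g (0, 1) q) p := by
  have hsnd : HasFDerivAt (fun q : EuclideanSpace ℝ (Fin N) × ℝ => q.2)
    (ContinuousLinearMap.snd ℝ _ ℝ) p := hasFDerivAt_snd
  rw [dirDeriv_mul hsnd.differentiableAt ((contDiff_greenFlux hf hg _).differentiable (by simp) p),
    dirDeriv_eq hsnd, ← Finset.mul_sum]
  simp only [dirDeriv_greenFlux hf hg, Finset.sum_sub_distrib, ← Finset.mul_sum,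
    ← halfSign_mul_self]
  simp only [weightedLap, greenFlux, ContinuousLinearMap.coe_snd']
  ring

/-- The operator `div(|t| ∇·)` is symmetric. -/
lemma integral_weightedLap_symm (hf : ContDiff ℝ (⊤ : ℕ∞) f) (hg : ContDiff ℝ (⊤ : ℕ∞) g)
    (hgc : HasCompactSupport g) :
    ∫ p, halfSign p.2 * (f p * weightedLap g p) = ∫ p, halfSign p.2 * (g p * weightedLap f p) := by
  have hv := hasCompactSupport_greenFlux (f := f) hgc
  have h1 : Integrable fun p => halfSign p.2 * (f p * weightedLap g p) :=
    integrable_halfSign_mul <| (hf.continuous.mul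
      (continuous_weightedLap hg)).integrable_of_hasCompactSupport
      (hasCompactSupport_weightedLap hgc).mul_left
  have h2 : Integrable fun p => halfSign p.2 * (g p * weightedLap f p) :=
    integrable_halfSign_mul <| (hg.continuous.mul
      (continuous_weightedLap hf)).integrable_of_hasCompactSupport hgc.mul_right
  have h3 : ∀ i : Fin N, Integrable fun p : EuclideanSpace ℝ (Fin N) × ℝ =>
      |p.2| * dirDeriv (horizDir i) (greenFlux f g (horizDir i)) p := fun i =>
    (((continuous_abs.comp continuous_snd).mul
      (contDiff_dirDeriv (contDiff_greenFlux hf hg _) _).continuous).integrable_of_hasCompactSupport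
      (hasCompactSupport_dirDeriv (hv _) _).mul_left)
  have h4 : ContDiff ℝ (⊤ : ℕ∞) fun q : EuclideanSpace ℝ (Fin N) × ℝ =>
      q.2 * greenFlux f g (0, 1) q := contDiff_snd.mul (contDiff_greenFlux hf hg _)
  have h5 : HasCompactSupport fun q : EuclideanSpace ℝ (Fin N) × ℝ =>
      q.2 * greenFlux f g (0, 1) q := (hv _).mul_left
  rw [← sub_eq_zero, ← integral_sub h1 h2, integral_congr_ae
    (Eventually.of_forall (weightedLap_green hf hg)), integral_add
      (integrable_finsetSum _ fun i _ => h3 i)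
      (integrable_halfSign_mul
        ((contDiff_dirDeriv h4 _).continuous.integrable_of_hasCompactSupport
          (hasCompactSupport_dirDeriv h5 _))),
    integral_finsetSum _ fun i _ => h3 i,
    integral_halfSign_mul_dirDeriv_vert h4 h5 (by simp), add_zero]
  exact Finset.sum_eq_zero fun i _ =>
    integral_abs_mul_dirDeriv_horiz (contDiff_greenFlux hf hg _) (hv _) _

end Green

section Kernel

variable {N : ℕ}

/-- The regularised squared Euclidean distance `|x|² + t² + e` to the origin. -/
def sqDist (e : ℝ) (p : EuclideanSpace ℝ (Fin N) × ℝ) : ℝ := ‖p.1‖ ^ 2 + p.2 ^ 2 + e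

lemma sqDist_pos {e : ℝ} (he : 0 < e) (p : EuclideanSpace ℝ (Fin N) × ℝ) : 0 < sqDist e p := by
  unfold sqDist; positivity

lemma contDiff_sqDist (e : ℝ) :
    ContDiff ℝ (⊤ : ℕ∞) (sqDist e : EuclideanSpace ℝ (Fin N) × ℝ → ℝ) :=
  ((contDiff_fst.norm_sq ℝ).add (contDiff_snd.pow 2)).add contDiff_const

lemma contDiff_sqDist_rpow {e : ℝ} (he : 0 < e) (b : ℝ) :
    ContDiff ℝ (⊤ : ℕ∞) fun p : EuclideanSpace ℝ (Fin N) × ℝ => sqDist e p ^ b :=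
  (contDiff_sqDist e).rpow_const_of_ne fun p => (sqDist_pos he p).ne'

/-- The Euclidean inner product with `v` on `ℝ^N × ℝ`. -/
def innerProd (v : EuclideanSpace ℝ (Fin N) × ℝ) : EuclideanSpace ℝ (Fin N) × ℝ →L[ℝ] ℝ :=
  (innerSL ℝ v.1).comp (ContinuousLinearMap.fst ℝ _ ℝ) + v.2 • ContinuousLinearMap.snd ℝ _ ℝ

lemma innerProd_apply (v p : EuclideanSpace ℝ (Fin N) × ℝ) :
    innerProd v p = inner ℝ v.1 p.1 + v.2 * p.2 := by
  simp [innerProd]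

lemma dirDeriv_innerProd (v p : EuclideanSpace ℝ (Fin N) × ℝ) :
    dirDeriv v (innerProd v) p = innerProd v v :=
  dirDeriv_eq (innerProd v).hasFDerivAt

lemma dirDeriv_sqDist_rpow {e : ℝ} (he : 0 < e) (b : ℝ) (v p : EuclideanSpace ℝ (Fin N) × ℝ) :
    dirDeriv v (fun q => sqDist e q ^ b) p = 2 * b * (innerProd v p * sqDist e p ^ (b - 1)) := by
  have h1 : HasFDerivAt (sqDist e) _ p :=
    ((hasFDerivAt_fst.norm_sq).add (hasFDerivAt_snd.pow 2)).add_const e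
  rw [dirDeriv_eq (h1.rpow_const (p := b) (Or.inl (sqDist_pos he p).ne'))]
  simp [innerProd_apply, sqDist, real_inner_comm]
  ring

lemma dirDeriv_dirDeriv_sqDist_rpow {e : ℝ} (he : 0 < e) (b : ℝ)
    (v p : EuclideanSpace ℝ (Fin N) × ℝ) :
    dirDeriv v (dirDeriv v fun q => sqDist e q ^ b) p
      = 2 * b * (innerProd v v * sqDist e p ^ (b - 1)
        + 2 * (b - 1) * (innerProd v p ^ 2 * sqDist e p ^ (b - 2))) := by
  have h1 : dirDeriv v (fun q => sqDist e q ^ b)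
      = fun p => 2 * b * (innerProd v p * sqDist e p ^ (b - 1)) :=
    funext fun p => dirDeriv_sqDist_rpow he b v p
  have h2 := (contDiff_sqDist_rpow (N := N) he (b - 1)).differentiable (by simp) p
  have h3 := (innerProd v).differentiableAt (x := p)
  rw [h1, dirDeriv_mul (differentiableAt_const _) (h3.fun_mul h2), dirDeriv_mul h3 h2,
    dirDeriv_innerProd, dirDeriv_sqDist_rpow he, show b - 1 - 1 = b - 2 by ring,
    dirDeriv_eq (hasFDerivAt_const (2 * b) p), zero_apply]
  ring

lemma weightedLap_sqDist_rpow {e : ℝ} (he : 0 < e) (p : EuclideanSpace ℝ (Fin N) × ℝ) :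
    weightedLap (fun q => sqDist e q ^ (-(N : ℝ) / 2)) p
      = -(N * (N + 2)) * (e * p.2 * sqDist e p ^ (-(N : ℝ) / 2 - 2)) := by
  have h1 : sqDist e p ^ (-(N : ℝ) / 2 - 1) = sqDist e p * sqDist e p ^ (-(N : ℝ) / 2 - 2) := by
    rw [← Real.rpow_one_add' (sqDist_pos he p).le]
    · ring_nf
    · have : (0 : ℝ) ≤ N := by positivity
      intro h; linarith
  have h2 : ‖p.1‖ ^ 2 = ∑ i, p.1 i ^ 2 := by
    simp [EuclideanSpace.norm_sq_eq]
  simp only [weightedLap, dirDeriv_dirDeriv_sqDist_rpow he, dirDeriv_sqDist_rpow he,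
    innerProd_apply, horizDir, h1]
  simp only [EuclideanSpace.inner_single_left, ← Finset.mul_sum, Finset.sum_add_distrib,
    ← Finset.sum_mul]
  simp [← h2]
  have h3 : ‖p.1‖ ^ 2 = sqDist e p - p.2 ^ 2 - e := by unfold sqDist; ring
  rw [h3]
  ring

lemma measurable_sqDist_rpow (e b : ℝ) :
    Measurable fun p : EuclideanSpace ℝ (Fin N) × ℝ => sqDist e p ^ b :=
  (contDiff_sqDist e).continuous.measurable.pow_const b

lemma norm_sq_le_sqDist_zero (p : EuclideanSpace ℝ (Fin N) × ℝ) : ‖p‖ ^ 2 ≤ sqDist 0 p := by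
  unfold sqDist
  rw [Prod.norm_def]
  rcases max_choice ‖p.1‖ ‖p.2‖ with h | h <;> rw [h]
  · nlinarith [sq_nonneg p.2]
  · rw [Real.norm_eq_abs, sq_abs]; nlinarith [sq_nonneg ‖p.1‖]

lemma sqDist_zero_nonneg (p : EuclideanSpace ℝ (Fin N) × ℝ) : 0 ≤ sqDist 0 p := by
  unfold sqDist; positivity

lemma sqDist_zero_rpow_le_norm_rpow {p : EuclideanSpace ℝ (Fin N) × ℝ} (hp : p ≠ 0) :
    sqDist 0 p ^ (-(N : ℝ) / 2) ≤ ‖p‖ ^ (-(N : ℝ)) := by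
  have h0 : 0 < ‖p‖ := norm_pos_iff.2 hp
  have hN : (0 : ℝ) ≤ N := by positivity
  calc sqDist 0 p ^ (-(N : ℝ) / 2) ≤ (‖p‖ ^ 2) ^ (-(N : ℝ) / 2) :=
        Real.rpow_le_rpow_of_nonpos (by positivity) (norm_sq_le_sqDist_zero p) (by linarith)
    _ = ‖p‖ ^ (-(N : ℝ)) := by
        rw [← Real.rpow_natCast, ← Real.rpow_mul h0.le]; congr 1; push_cast; ring

lemma integrableOn_sqDist_zero_rpow :
    IntegrableOn (fun p : EuclideanSpace ℝ (Fin N) × ℝ => sqDist 0 p ^ (-(N : ℝ) / 2))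
      (ball 0 1) := by
  have h1 : IntegrableOn (fun p : EuclideanSpace ℝ (Fin N) × ℝ => ‖p‖ ^ (-(N : ℝ)))
      (ball 0 1) := by
    rw [integrableOn_fun_norm_addHaar volume (f := fun r => r ^ (-(N : ℝ)))]
    refine (integrableOn_const (C := (1 : ℝ)) (by simp)).congr_fun (fun r hr => ?_)
      measurableSet_Ioo
    have : Module.finrank ℝ (EuclideanSpace ℝ (Fin N) × ℝ) - 1 = N := by simp
    rw [this, smul_eq_mul, Real.rpow_neg hr.1.le, Real.rpow_natCast,
      mul_inv_cancel₀ (pow_pos hr.1 N).ne']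
  refine h1.mono' (measurable_sqDist_rpow _ _).aestronglyMeasurable ?_
  filter_upwards [ae_restrict_of_ae (Measure.ae_ne volume (0 : EuclideanSpace ℝ (Fin N) × ℝ))]
    with p hp
  rw [Real.norm_of_nonneg (Real.rpow_nonneg (sqDist_zero_nonneg p) _)]
  exact sqDist_zero_rpow_le_norm_rpow hp

/-- The singular part of the kernel `(|x|² + t²)^(-N/2)`. -/
def singKer (N : ℕ) : EuclideanSpace ℝ (Fin N) × ℝ → ℝ :=
  (ball 0 1).indicator fun p => sqDist 0 p ^ (-(N : ℝ) / 2)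

lemma measurable_singKer : Measurable (singKer N) :=
  (measurable_sqDist_rpow _ _).indicator measurableSet_ball

lemma integrable_singKer : Integrable (singKer N) :=
  (integrable_indicator_iff measurableSet_ball).2 integrableOn_sqDist_zero_rpow

lemma singKer_nonneg (p) : 0 ≤ singKer N p :=
  indicator_nonneg (fun p _ => Real.rpow_nonneg (sqDist_zero_nonneg p) _) p

lemma sqDist_zero_rpow_le (p : EuclideanSpace ℝ (Fin N) × ℝ) :
    sqDist 0 p ^ (-(N : ℝ) / 2) ≤ 1 + singKer N p := by
  by_cases hp : p ∈ ball 0 1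
  · simp [singKer, hp]
  · have h1 : 1 ≤ ‖p‖ := by simpa using hp
    have hN : (0 : ℝ) ≤ N := by positivity
    simp only [singKer, hp, not_false_eq_true, indicator_of_notMem, add_zero]
    exact Real.rpow_le_one_of_one_le_of_nonpos
      ((one_le_pow₀ h1).trans (norm_sq_le_sqDist_zero p)) (by linarith)

lemma integrable_sqDist_zero_rpow_mul {g : EuclideanSpace ℝ (Fin N) × ℝ → ℝ}
    (hg : Continuous g) (hgc : HasCompactSupport g) :
    Integrable fun p => sqDist 0 p ^ (-(N : ℝ) / 2) * g p := by
  obtain ⟨M, hM⟩ := hgc.exists_bound_of_continuous hg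
  refine Integrable.mono' (g := fun p => |g p| + singKer N p * M)
    ((hg.integrable_of_hasCompactSupport hgc).abs.add (integrable_singKer.mul_const M))
    ((measurable_sqDist_rpow _ _).mul hg.measurable).aestronglyMeasurable
    (Eventually.of_forall fun p => ?_)
  rw [norm_mul, Real.norm_of_nonneg (Real.rpow_nonneg (sqDist_zero_nonneg p) _)]
  calc _ ≤ (1 + singKer N p) * ‖g p‖ := by gcongr; exact sqDist_zero_rpow_le p
    _ = |g p| + singKer N p * ‖g p‖ := by rw [Real.norm_eq_abs]; ring
    _ ≤ _ := by gcongr; exacts [singKer_nonneg p, hM p]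

section Mass

lemma tendsto_add_sq_rpow_atTop (a : ℝ) {b : ℝ} (hb : b < 0) :
    Tendsto (fun t : ℝ => (a + t ^ 2) ^ b) atTop (𝓝 0) := by
  have h1 : Tendsto (fun t : ℝ => a + t ^ 2) atTop atTop :=
    tendsto_atTop_add_const_left _ _ (tendsto_pow_atTop two_ne_zero)
  have h2 := (tendsto_rpow_neg_atTop (neg_pos.2 hb)).comp h1
  rw [neg_neg] at h2
  exact h2

lemma integrable_abs_mul_add_sq_rpow {a b : ℝ} (ha : 0 < a) (hb : b < -1) :
    Integrable (fun t : ℝ => |t| * (a + t ^ 2) ^ b) ∧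
      ∫ t : ℝ, |t| * (a + t ^ 2) ^ b = a ^ (b + 1) / -(b + 1) := by
  have hb0 : b + 1 ≠ 0 := by linarith
  have hd : ∀ t ∈ Ici (0 : ℝ), HasDerivAt (fun t : ℝ => (a + t ^ 2) ^ (b + 1) / (2 * (b + 1)))
      (t * (a + t ^ 2) ^ b) t := fun t _ => by
    have h1 : HasDerivAt (fun t : ℝ => a + t ^ 2) (2 * t) t := by
      simpa using (hasDerivAt_pow 2 t).const_add a
    refine ((h1.rpow_const (p := b + 1) (Or.inl (by positivity))).div_const
      (2 * (b + 1))).congr_deriv ?_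
    rw [add_sub_cancel_right]
    field_simp
  have hp : ∀ t ∈ Ioi (0 : ℝ), 0 ≤ t * (a + t ^ 2) ^ b := fun t ht => by
    have : 0 < t := ht
    positivity
  have hl : Tendsto (fun t : ℝ => (a + t ^ 2) ^ (b + 1) / (2 * (b + 1))) atTop (𝓝 0) := by
    simpa using (tendsto_add_sq_rpow_atTop a (b := b + 1) (by linarith)).div_const (2 * (b + 1))
  constructor
  · have := integrable_fun_norm_addHaar (volume : Measure ℝ) (f := fun t => t * (a + t ^ 2) ^ b)
    simp only [Real.norm_eq_abs, sq_abs] at this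
    rw [this]
    simpa using integrableOn_Ioi_deriv_of_nonneg' hd hp hl
  · have := integral_comp_abs (f := fun t => t * (a + t ^ 2) ^ b)
    simp only [sq_abs] at this
    rw [this, integral_Ioi_of_hasDerivAt_of_nonneg' hd hp hl]
    simp only [ne_eq, OfNat.ofNat_ne_zero, not_false_eq_true, zero_pow, add_zero, div_neg]
    field_simp
    ring

lemma integrable_one_add_norm_sq_rpow (hN : 1 ≤ N) :
    Integrable (fun x : EuclideanSpace ℝ (Fin N) => (1 + ‖x‖ ^ 2) ^ (-(N : ℝ) / 2 - 1)) ∧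
      ∫ x : EuclideanSpace ℝ (Fin N), (1 + ‖x‖ ^ 2) ^ (-(N : ℝ) / 2 - 1)
        = volume.real (ball (0 : EuclideanSpace ℝ (Fin N)) 1) := by
  have hN' : (0 : ℝ) < N := by exact_mod_cast hN
  have : Nontrivial (EuclideanSpace ℝ (Fin N)) := by
    have : Nonempty (Fin N) := ⟨⟨0, hN⟩⟩
    infer_instance
  have hd : ∀ r ∈ Ici (0 : ℝ), HasDerivAt (fun r : ℝ => r ^ N * (1 + r ^ 2) ^ (-(N : ℝ) / 2) / N)
      (r ^ (N - 1) * (1 + r ^ 2) ^ (-(N : ℝ) / 2 - 1)) r := fun r _ => by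
    have h0 : 0 < 1 + r ^ 2 := by positivity
    have h1 : HasDerivAt (fun t : ℝ => 1 + t ^ 2) (2 * r) r := by
      simpa using (hasDerivAt_pow 2 r).const_add 1
    refine (((hasDerivAt_pow N r).mul (h1.rpow_const (p := -(N : ℝ) / 2)
      (Or.inl h0.ne'))).div_const (N : ℝ)).congr_deriv ?_
    have h2 : (1 + r ^ 2) ^ (-(N : ℝ) / 2) = (1 + r ^ 2) * (1 + r ^ 2) ^ (-(N : ℝ) / 2 - 1) := by
      rw [← Real.rpow_one_add' h0.le]
      · ring_nf
      · intro h; linarith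
    have h3 : r ^ N = r * r ^ (N - 1) := by rw [← pow_succ', Nat.sub_add_cancel hN]
    rw [h2, h3]
    field_simp
    ring
  have hp : ∀ r ∈ Ioi (0 : ℝ), 0 ≤ r ^ (N - 1) * (1 + r ^ 2) ^ (-(N : ℝ) / 2 - 1) := fun r hr => by
    have : 0 < r := hr
    positivity
  have hl : Tendsto (fun r : ℝ => r ^ N * (1 + r ^ 2) ^ (-(N : ℝ) / 2) / (N : ℝ)) atTop
      (𝓝 (1 / (N : ℝ))) := by
    have h1 : Tendsto (fun r : ℝ => (r ^ 2)⁻¹) atTop (𝓝 0) :=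
      tendsto_inv_atTop_zero.comp (tendsto_pow_atTop two_ne_zero)
    have h2 : Tendsto (fun r : ℝ => (1 + (r ^ 2)⁻¹) ^ (-(N : ℝ) / 2)) atTop (𝓝 1) := by
      simpa using (h1.const_add 1).rpow_const (p := -(N : ℝ) / 2) (by simp)
    refine Tendsto.div_const (h2.congr' ?_) _
    filter_upwards [eventually_gt_atTop 0] with r hr
    have h3 : 1 + r ^ 2 = r ^ 2 * (1 + (r ^ 2)⁻¹) := by field_simp; ring
    rw [h3, Real.mul_rpow (by positivity) (by positivity), ← mul_assoc, ← Real.rpow_natCast r 2,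
      ← Real.rpow_mul hr.le, ← Real.rpow_natCast r N, ← Real.rpow_add hr]
    simp [mul_div_cancel₀]
  constructor
  · rw [integrable_fun_norm_addHaar volume (f := fun r => (1 + r ^ 2) ^ (-(N : ℝ) / 2 - 1))]
    simpa using integrableOn_Ioi_deriv_of_nonneg' hd hp hl
  · rw [integral_fun_norm_addHaar volume (fun r => (1 + r ^ 2) ^ (-(N : ℝ) / 2 - 1))]
    simp only [finrank_euclideanSpace, Fintype.card_fin, smul_eq_mul, nsmul_eq_mul]
    rw [integral_Ioi_of_hasDerivAt_of_nonneg' hd hp hl]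
    have : N ≠ 0 := by omega
    simp [this]
    field_simp

lemma cN_pos (hN : 1 ≤ N) : 0 < cN N := by
  have hN' : (0 : ℝ) < N := by exact_mod_cast hN
  exact div_pos (Real.Gamma_pos_of_pos (by positivity)) (by positivity)

lemma volume_real_unit_ball (hN : 1 ≤ N) :
    volume.real (ball (0 : EuclideanSpace ℝ (Fin N)) 1) = 2 / (N * cN N) := by
  have hN' : (0 : ℝ) < N := by exact_mod_cast hN
  have : Nonempty (Fin N) := ⟨⟨0, hN⟩⟩
  have hG : 0 < Real.Gamma ((N : ℝ) / 2) := Real.Gamma_pos_of_pos (by positivity)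
  have h1 : √π ^ N = π ^ ((N : ℝ) / 2) := by
    rw [Real.sqrt_eq_rpow, ← Real.rpow_natCast, ← Real.rpow_mul Real.pi_pos.le]
    congr 1; ring
  rw [Measure.real, EuclideanSpace.volume_ball, Fintype.card_fin,
    Real.Gamma_add_one (by positivity), h1, cN]
  have h2 : 0 < π ^ ((N : ℝ) / 2) := by positivity
  simp only [ENNReal.ofReal_one, one_pow, one_mul]
  rw [ENNReal.toReal_ofReal (by positivity)]
  field_simp

lemma integrable_abs_mul_sqDist_one_rpow (hN : 1 ≤ N) :
    Integrable (fun p : EuclideanSpace ℝ (Fin N) × ℝ => |p.2| * sqDist 1 p ^ (-(N : ℝ) / 2 - 2)) ∧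
      ∫ p : EuclideanSpace ℝ (Fin N) × ℝ, |p.2| * sqDist 1 p ^ (-(N : ℝ) / 2 - 2)
        = 4 / (N * (N + 2) * cN N) := by
  have hN' : (0 : ℝ) < N := by exact_mod_cast hN
  have hs : ∀ x : EuclideanSpace ℝ (Fin N), _ := fun x =>
    integrable_abs_mul_add_sq_rpow (a := 1 + ‖x‖ ^ 2) (b := -(N : ℝ) / 2 - 2)
      (by positivity) (by linarith)
  have he : ∀ (x : EuclideanSpace ℝ (Fin N)) (t : ℝ), sqDist 1 (x, t) = 1 + ‖x‖ ^ 2 + t ^ 2 :=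
    fun x t => by simp only [sqDist]; ring
  have h1 : (-(N : ℝ) / 2 - 2 + 1) = -(N : ℝ) / 2 - 1 := by ring
  simp only [h1, ← he] at hs
  have hi : Integrable fun p : EuclideanSpace ℝ (Fin N) × ℝ =>
      |p.2| * sqDist 1 p ^ (-(N : ℝ) / 2 - 2) := by
    have hm : Measurable fun p : EuclideanSpace ℝ (Fin N) × ℝ =>
        |p.2| * sqDist 1 p ^ (-(N : ℝ) / 2 - 2) :=
      (continuous_abs.measurable.comp measurable_snd).mul (measurable_sqDist_rpow 1 _)
    rw [Measure.volume_eq_prod, integrable_prod_iff hm.aestronglyMeasurable]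
    refine ⟨Eventually.of_forall fun x => (hs x).1, ?_⟩
    have h2 : ∀ (x : EuclideanSpace ℝ (Fin N)) (t : ℝ),
        ‖|t| * sqDist 1 (x, t) ^ (-(N : ℝ) / 2 - 2)‖ = |t| * sqDist 1 (x, t) ^ (-(N : ℝ) / 2 - 2) :=
      fun x t => Real.norm_of_nonneg (by have := sqDist_pos one_pos (x, t); positivity)
    simp only [h2, (hs _).2]
    exact (integrable_one_add_norm_sq_rpow hN).1.div_const _
  refine ⟨hi, ?_⟩
  rw [Measure.volume_eq_prod, integral_prod _ hi]
  simp only [(hs _).2]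
  rw [integral_div, (integrable_one_add_norm_sq_rpow hN).2, volume_real_unit_ball hN]
  have := cN_pos hN
  have : (0 : ℝ) < N + 2 := by positivity
  rw [show -(-(N : ℝ) / 2 - 1) = (N + 2) / 2 by ring]
  field_simp
  ring

end Mass

lemma sqDist_smul (ε : ℝ) (p : EuclideanSpace ℝ (Fin N) × ℝ) :
    sqDist (ε ^ 2) (ε • p) = ε ^ 2 * sqDist 1 p := by
  simp only [sqDist, Prod.smul_fst, Prod.smul_snd, norm_smul, Real.norm_eq_abs, mul_pow, sq_abs,
    smul_eq_mul]
  ring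

lemma integral_mul_weightedLap_sqDist_rpow (g : EuclideanSpace ℝ (Fin N) × ℝ → ℝ) {ε : ℝ}
    (hε : 0 < ε) :
    ∫ p, halfSign p.2 * (g p * weightedLap (fun q => sqDist (ε ^ 2) q ^ (-(N : ℝ) / 2)) p)
      = -(N * (N + 2)) * ∫ p : EuclideanSpace ℝ (Fin N) × ℝ,
        g (ε • p) * (|p.2| * sqDist 1 p ^ (-(N : ℝ) / 2 - 2)) := by
  set h : EuclideanSpace ℝ (Fin N) × ℝ → ℝ := fun p =>
    g p * (ε ^ 2 * |p.2| * sqDist (ε ^ 2) p ^ (-(N : ℝ) / 2 - 2)) with hh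
  have h1 : ∀ p, halfSign p.2 * (g p * weightedLap (fun q => sqDist (ε ^ 2) q ^ (-(N : ℝ) / 2)) p)
      = -(N * (N + 2)) * h p := fun p => by
    simp only [hh]
    rw [weightedLap_sqDist_rpow (by positivity), ← halfSign_mul_self]
    ring
  have h2 : ε ^ 2 * ε * (ε ^ 2) ^ (-(N : ℝ) / 2 - 2) = (ε ^ (N + 1))⁻¹ := by
    rw [← Real.rpow_natCast, ← Real.rpow_mul hε.le, ← Real.rpow_natCast ε (N + 1),
      ← Real.rpow_neg hε.le, ← Real.rpow_add_one hε.ne', ← Real.rpow_add hε]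
    congr 1; push_cast; ring
  have h3 : ∀ p, h (ε • p) = (ε ^ (N + 1))⁻¹ *
      (g (ε • p) * (|p.2| * sqDist 1 p ^ (-(N : ℝ) / 2 - 2))) := fun p => by
    simp only [hh]
    rw [sqDist_smul, Real.mul_rpow (by positivity) (sqDist_pos one_pos p).le, ← h2,
      Prod.smul_snd, smul_eq_mul, abs_mul, abs_of_pos hε]
    ring
  have h4 := Measure.integral_comp_smul_of_nonneg volume h ε (hR := hε.le)
  simp only [h3] at h4
  rw [integral_const_mul, smul_eq_mul] at h4
  have h5 : Module.finrank ℝ (EuclideanSpace ℝ (Fin N) × ℝ) = N + 1 := by simp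
  rw [h5] at h4
  simp only [h1]
  rw [integral_const_mul, mul_left_cancel₀ (by positivity) h4]

/-- The fundamental solution property of `(|x|² + t²)^(-N/2)` for `div(|t| ∇·)`. -/
lemma integral_sqDist_zero_rpow_mul_weightedLap (hN : 1 ≤ N)
    {g : EuclideanSpace ℝ (Fin N) × ℝ → ℝ} (hg : ContDiff ℝ (⊤ : ℕ∞) g)
    (hgc : HasCompactSupport g) :
    ∫ p, halfSign p.2 * (sqDist 0 p ^ (-(N : ℝ) / 2) * weightedLap g p)
      = -(4 / cN N) * g 0 := by
  have hN' : (0 : ℝ) < N := by exact_mod_cast hN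
  have hcN := cN_pos hN
  have hL : Tendsto (fun ε : ℝ => ∫ p : EuclideanSpace ℝ (Fin N) × ℝ,
      halfSign p.2 * (sqDist (ε ^ 2) p ^ (-(N : ℝ) / 2) * weightedLap g p)) (𝓝[>] 0)
      (𝓝 (∫ p, halfSign p.2 * (sqDist 0 p ^ (-(N : ℝ) / 2) * weightedLap g p))) := by
    refine tendsto_integral_filter_of_dominated_convergence
      (fun p => ‖sqDist 0 p ^ (-(N : ℝ) / 2) * weightedLap g p‖)
      (Eventually.of_forall fun ε => ?_) (Eventually.of_forall fun ε => ?_)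
      (integrable_sqDist_zero_rpow_mul (continuous_weightedLap hg)
        (hasCompactSupport_weightedLap hgc)).norm ?_
    · exact ((measurable_halfSign.comp measurable_snd).mul ((measurable_sqDist_rpow _ _).mul
        (continuous_weightedLap hg).measurable)).aestronglyMeasurable
    · filter_upwards [Measure.ae_ne volume (0 : EuclideanSpace ℝ (Fin N) × ℝ)] with p hp
      have h0 : 0 < sqDist 0 p :=
        (pow_pos (norm_pos_iff.2 hp) 2).trans_le (norm_sq_le_sqDist_zero p)
      have h1 : sqDist 0 p ≤ sqDist (ε ^ 2) p := by
        unfold sqDist; nlinarith [sq_nonneg ε]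
      rw [norm_mul, Real.norm_eq_abs (halfSign _), abs_halfSign, one_mul, norm_mul, norm_mul,
        Real.norm_of_nonneg (Real.rpow_nonneg h0.le _),
        Real.norm_of_nonneg (Real.rpow_nonneg (h0.le.trans h1) _)]
      gcongr ?_ * _
      exact Real.rpow_le_rpow_of_nonpos h0 h1 (by linarith)
    · filter_upwards [Measure.ae_ne volume (0 : EuclideanSpace ℝ (Fin N) × ℝ)] with p hp
      have h0 : 0 < sqDist 0 p :=
        (pow_pos (norm_pos_iff.2 hp) 2).trans_le (norm_sq_le_sqDist_zero p)
      have h1 : Tendsto (fun ε : ℝ => sqDist (ε ^ 2) p) (𝓝[>] 0) (𝓝 (sqDist 0 p)) := by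
        have : Continuous fun ε : ℝ => sqDist (ε ^ 2) p := by unfold sqDist; fun_prop
        simpa using (this.tendsto 0).mono_left nhdsWithin_le_nhds
      exact ((h1.rpow_const (Or.inl h0.ne')).mul_const _).const_mul _
  have hR : Tendsto (fun ε : ℝ => -((N : ℝ) * (N + 2)) * ∫ p : EuclideanSpace ℝ (Fin N) × ℝ,
      g (ε • p) * (|p.2| * sqDist 1 p ^ (-(N : ℝ) / 2 - 2))) (𝓝[>] 0)
      (𝓝 (-((N : ℝ) * (N + 2)) * ∫ p : EuclideanSpace ℝ (Fin N) × ℝ,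
        g 0 * (|p.2| * sqDist 1 p ^ (-(N : ℝ) / 2 - 2)))) := by
    obtain ⟨M, hM⟩ := hgc.exists_bound_of_continuous hg.continuous
    have hi := (integrable_abs_mul_sqDist_one_rpow hN).1
    refine (tendsto_integral_filter_of_dominated_convergence
      (fun p => M * ‖|p.2| * sqDist 1 p ^ (-(N : ℝ) / 2 - 2)‖)
      (Eventually.of_forall fun ε => ?_) (Eventually.of_forall fun ε =>
        Eventually.of_forall fun p => ?_)
      (hi.norm.const_mul M) (Eventually.of_forall fun p => ?_)).const_mul _
    · exact (hg.continuous.comp (continuous_const_smul ε)).aestronglyMeasurable.mul hi.1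
    · rw [norm_mul]; gcongr; exact hM _
    · have : Continuous fun ε : ℝ => g (ε • p) :=
        hg.continuous.comp (continuous_id.smul continuous_const)
      have := (this.tendsto 0).mono_left (nhdsWithin_le_nhds (s := Ioi 0))
      rw [zero_smul] at this
      exact this.mul_const _
  have hE : ∀ ε ∈ Ioi (0 : ℝ), ∫ p : EuclideanSpace ℝ (Fin N) × ℝ,
      halfSign p.2 * (sqDist (ε ^ 2) p ^ (-(N : ℝ) / 2) * weightedLap g p)
      = -((N : ℝ) * (N + 2)) * ∫ p : EuclideanSpace ℝ (Fin N) × ℝ,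
      g (ε • p) * (|p.2| * sqDist 1 p ^ (-(N : ℝ) / 2 - 2)) := fun ε hε => by
    have : (0 : ℝ) < ε := hε
    rw [← integral_mul_weightedLap_sqDist_rpow g hε,
      integral_weightedLap_symm (contDiff_sqDist_rpow (by positivity) _) hg hgc]
  rw [tendsto_nhds_unique hL (hR.congr' ((eventually_mem_nhdsWithin).mono
    fun ε hε => (hE ε hε).symm)), integral_const_mul, (integrable_abs_mul_sqDist_one_rpow hN).2]
  field_simp

end Kernel

section Fubini

variable {N : ℕ} {u : EuclideanSpace ℝ (Fin N) → ℝ} {g : EuclideanSpace ℝ (Fin N) × ℝ → ℝ}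

lemma one_add_norm_pow_mul_le {R : ℝ} (hR : 0 ≤ R) (y : EuclideanSpace ℝ (Fin N))
    {p : EuclideanSpace ℝ (Fin N) × ℝ} (hp : ‖p.1‖ ≤ R) :
    (1 + ‖y‖) ^ N * sqDist 0 (p - (y, 0)) ^ (-(N : ℝ) / 2)
      ≤ 2 ^ (N - 1) * ((1 + R) ^ N + 1) * (1 + singKer N (p - (y, 0))) := by
  set k := sqDist 0 (p - (y, 0)) ^ (-(N : ℝ) / 2)
  have hk : 0 ≤ k := Real.rpow_nonneg (sqDist_zero_nonneg _) _
  have h1 : ‖p.1 - y‖ ^ N * k ≤ 1 := by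
    have hs : ‖p.1 - y‖ ^ 2 ≤ sqDist 0 (p - (y, 0)) := by
      simp only [sqDist, Prod.fst_sub]; nlinarith [sq_nonneg (p - (y, 0)).2]
    have h2 : ‖p.1 - y‖ ^ N ≤ sqDist 0 (p - (y, 0)) ^ ((N : ℝ) / 2) := by
      calc ‖p.1 - y‖ ^ N = (‖p.1 - y‖ ^ 2) ^ ((N : ℝ) / 2) := by
            rw [← Real.rpow_natCast, ← Real.rpow_natCast, ← Real.rpow_mul (norm_nonneg _)]
            congr 1; push_cast; ring
        _ ≤ _ := by gcongr
    calc ‖p.1 - y‖ ^ N * k ≤ sqDist 0 (p - (y, 0)) ^ ((N : ℝ) / 2) * k := by gcongr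
      _ ≤ 1 := by
        simp only [k]
        rw [neg_div, Real.rpow_neg (sqDist_zero_nonneg _)]
        exact mul_inv_le_one
  have h3 : 1 + ‖y‖ ≤ (1 + R) + ‖p.1 - y‖ := by
    have := norm_sub_norm_le y p.1
    rw [norm_sub_rev] at this
    linarith
  have h4 := singKer_nonneg (p - (y, 0))
  calc (1 + ‖y‖) ^ N * k ≤ ((1 + R) + ‖p.1 - y‖) ^ N * k := by gcongr
    _ ≤ (2 ^ (N - 1) * ((1 + R) ^ N + ‖p.1 - y‖ ^ N)) * k := by
        gcongr; exact add_pow_le (by positivity) (norm_nonneg _) N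
    _ = 2 ^ (N - 1) * ((1 + R) ^ N * k + ‖p.1 - y‖ ^ N * k) := by ring
    _ ≤ 2 ^ (N - 1) * ((1 + R) ^ N * (1 + singKer N (p - (y, 0)))
          + 1 * (1 + singKer N (p - (y, 0)))) := by
        have := mul_le_mul_of_nonneg_left (sqDist_zero_rpow_le (p - (y, 0)))
          (by positivity : 0 ≤ (1 + R) ^ N)
        refine mul_le_mul_of_nonneg_left (add_le_add this ?_) (by positivity)
        linarith
    _ = _ := by ring

lemma integrable_mul_singKer_sub {v : EuclideanSpace ℝ (Fin N) → ℝ} (hv : Integrable v) :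
    Integrable fun q : EuclideanSpace ℝ (Fin N) × (EuclideanSpace ℝ (Fin N) × ℝ) =>
      v q.1 * singKer N (q.2 - (q.1, 0)) := by
  have hm : Measurable fun q : EuclideanSpace ℝ (Fin N) × (EuclideanSpace ℝ (Fin N) × ℝ) =>
      singKer N (q.2 - (q.1, 0)) :=
    measurable_singKer.comp (measurable_snd.sub (measurable_fst.prodMk measurable_const))
  have h : ∀ (c : ℝ) (y : EuclideanSpace ℝ (Fin N)),
      Integrable fun p : EuclideanSpace ℝ (Fin N) × ℝ =>
      c * singKer N (p - (y, 0)) :=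
    fun c y => (integrable_singKer.comp_sub_right (y, 0)).const_mul c
  have hm' : AEStronglyMeasurable
      (fun q : EuclideanSpace ℝ (Fin N) × (EuclideanSpace ℝ (Fin N) × ℝ) =>
        v q.1 * singKer N (q.2 - (q.1, 0))) (volume.prod volume) :=
    hv.1.comp_fst.mul hm.aestronglyMeasurable
  rw [Measure.volume_eq_prod, integrable_prod_iff hm']
  refine ⟨Eventually.of_forall fun y => h (v y) y, ?_⟩
  have h2 : ∀ y : EuclideanSpace ℝ (Fin N), ∫ p, ‖v y * singKer N (p - (y, 0))‖
      = ‖v y‖ * ∫ p, singKer N p := fun y => by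
    rw [← integral_sub_right_eq_self (singKer N) (y, 0), ← integral_const_mul]
    congr 1 with p
    rw [norm_mul, Real.norm_of_nonneg (singKer_nonneg _)]
  simp only [h2]
  exact hv.norm.mul_const _

lemma integrable_kernel_mul (hu : MemL10 N u) (hg : Continuous g) (hgc : HasCompactSupport g) :
    Integrable fun q : EuclideanSpace ℝ (Fin N) × (EuclideanSpace ℝ (Fin N) × ℝ) =>
      u q.1 * (halfSign q.2.2 * (sqDist 0 (q.2 - (q.1, 0)) ^ (-(N : ℝ) / 2) * g q.2)) := by
  obtain ⟨M, hM⟩ := hgc.exists_bound_of_continuous hg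
  obtain ⟨R, hR0, hR⟩ := hgc.isCompact.isBounded.exists_pos_norm_le
  set C : ℝ := 2 ^ (N - 1) * ((1 + R) ^ N + 1)
  set v : EuclideanSpace ℝ (Fin N) → ℝ := fun x => (1 + ‖x‖) ^ (-(N : ℝ)) * |u x|
  have hv : Integrable v := hu.2
  have hM0 : 0 ≤ M := (norm_nonneg _).trans (hM 0)
  have hmaj : Integrable fun q : EuclideanSpace ℝ (Fin N) × (EuclideanSpace ℝ (Fin N) × ℝ) =>
      C * (v q.1 * |g q.2| + M * (v q.1 * singKer N (q.2 - (q.1, 0)))) :=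
    ((hv.mul_prod (hg.integrable_of_hasCompactSupport hgc).abs).add
      ((integrable_mul_singKer_sub hv).const_mul M)).const_mul C
  have hm : Measurable fun q : EuclideanSpace ℝ (Fin N) × (EuclideanSpace ℝ (Fin N) × ℝ) =>
      halfSign q.2.2 * (sqDist 0 (q.2 - (q.1, 0)) ^ (-(N : ℝ) / 2) * g q.2) :=
    (measurable_halfSign.comp (measurable_snd.comp measurable_snd)).mul
      (((measurable_sqDist_rpow _ _).comp
        (measurable_snd.sub (measurable_fst.prodMk measurable_const))).mul
        (hg.measurable.comp measurable_snd))
  refine hmaj.mono' (hu.1.aestronglyMeasurable.comp_fst.mul hm.aestronglyMeasurable)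
    (Eventually.of_forall fun ⟨y, p⟩ => ?_)
  simp only
  by_cases hp : g p = 0
  · have := singKer_nonneg (p - (y, 0))
    simp only [hp, mul_zero, norm_zero, abs_zero, zero_add]
    positivity
  have hpR : ‖p.1‖ ≤ R := (norm_fst_le p).trans (hR p (subset_tsupport g hp))
  have hk : 0 ≤ sqDist 0 (p - (y, 0)) ^ (-(N : ℝ) / 2) :=
    Real.rpow_nonneg (sqDist_zero_nonneg _) _
  have h1 : |u y| = v y * (1 + ‖y‖) ^ N := by
    simp only [v]
    rw [Real.rpow_neg (by positivity), Real.rpow_natCast]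
    field_simp
  have hv0 : 0 ≤ v y := by positivity
  rw [norm_mul, norm_mul, norm_mul, Real.norm_eq_abs, Real.norm_eq_abs, abs_halfSign, one_mul,
    Real.norm_of_nonneg hk, h1]
  calc v y * (1 + ‖y‖) ^ N * (sqDist 0 (p - (y, 0)) ^ (-(N : ℝ) / 2) * ‖g p‖)
      = v y * ((1 + ‖y‖) ^ N * sqDist 0 (p - (y, 0)) ^ (-(N : ℝ) / 2)) * ‖g p‖ := by ring
    _ ≤ v y * (C * (1 + singKer N (p - (y, 0)))) * ‖g p‖ := by
        exact mul_le_mul_of_nonneg_right (mul_le_mul_of_nonneg_left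
          (one_add_norm_pow_mul_le hR0.le y hpR) hv0) (norm_nonneg _)
    _ = C * (v y * ‖g p‖ + ‖g p‖ * (v y * singKer N (p - (y, 0)))) := by ring
    _ ≤ C * (v y * ‖g p‖ + M * (v y * singKer N (p - (y, 0)))) := by
        have := singKer_nonneg (p - (y, 0))
        gcongr
        exact hM p

end Fubini

section TestFunction

variable {N : ℕ} {φ : EuclideanSpace ℝ (Fin N) × ℝ → ℝ}

lemma dirDeriv_comp_add {F : Type*} [NormedAddCommGroup F] [NormedSpace ℝ F] (v a : F)
    (f : F → ℝ) : dirDeriv v (fun q => f (q + a)) = fun q => dirDeriv v f (q + a) := by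
  ext q
  simp only [dirDeriv, fderiv_comp_add_right]

lemma weightedLap_comp_add (y : EuclideanSpace ℝ (Fin N)) (p : EuclideanSpace ℝ (Fin N) × ℝ) :
    weightedLap (fun q => φ (q + (y, 0))) p = weightedLap φ (p + (y, 0)) := by
  simp only [weightedLap, dirDeriv_comp_add]
  simp

lemma integral_translated_kernel_mul_weightedLap (hN : 1 ≤ N) (hφ : ContDiff ℝ (⊤ : ℕ∞) φ)
    (hφc : HasCompactSupport φ) (y : EuclideanSpace ℝ (Fin N)) :
    ∫ p, halfSign p.2 * (sqDist 0 (p - (y, 0)) ^ (-(N : ℝ) / 2) * weightedLap φ p)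
      = -(4 / cN N) * φ (y, 0) := by
  have h := integral_sqDist_zero_rpow_mul_weightedLap hN
    (g := fun q => φ (q + (y, 0))) (hφ.comp (contDiff_id.add contDiff_const))
    (hφc.comp_homeomorph (Homeomorph.addRight (y, 0)))
  rw [zero_add] at h
  rw [← h, ← integral_add_right_eq_self _ ((y, 0) : EuclideanSpace ℝ (Fin N) × ℝ)]
  simp [weightedLap_comp_add]

lemma hasDerivAt_line {F : Type*} [NormedAddCommGroup F] [NormedSpace ℝ F] {f : F → ℝ}
    (hf : ContDiff ℝ (⊤ : ℕ∞) f) (p v : F) (s : ℝ) :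
    HasDerivAt (fun s : ℝ => f (p + s • v)) (dirDeriv v f (p + s • v)) s := by
  have h1 := (hf.differentiable (by simp) (p + s • v)).hasFDerivAt
  have h2 : HasDerivAt (fun s : ℝ => p + s • v) v s := by
    simpa using ((hasDerivAt_id s).smul_const v).const_add p
  exact h1.comp_hasDerivAt s h2

lemma iteratedDeriv_two_line {F : Type*} [NormedAddCommGroup F] [NormedSpace ℝ F] {f : F → ℝ}
    (hf : ContDiff ℝ (⊤ : ℕ∞) f) (p v : F) :
    iteratedDeriv 2 (fun s : ℝ => f (p + s • v)) 0 = dirDeriv v (dirDeriv v f) p := by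
  have h1 : deriv (fun s : ℝ => f (p + s • v)) = fun s => dirDeriv v f (p + s • v) :=
    funext fun s => (hasDerivAt_line hf p v s).deriv
  rw [iteratedDeriv_succ, iteratedDeriv_one, h1,
    (hasDerivAt_line (contDiff_dirDeriv hf v) p v 0).deriv, zero_smul, add_zero]

lemma hasDerivAt_vert (hφ : ContDiff ℝ (⊤ : ℕ∞) φ) (x : EuclideanSpace ℝ (Fin N)) (t : ℝ) :
    HasDerivAt (fun τ : ℝ => φ (x, τ)) (dirDeriv (0, 1) φ (x, t)) t := by
  simpa using hasDerivAt_line hφ (x, 0) (0, 1) t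

lemma weightedDiv_eq (hφ : ContDiff ℝ (⊤ : ℕ∞) φ) {p : EuclideanSpace ℝ (Fin N) × ℝ}
    (hp : p.2 ≠ 0) :
    |p.2| * (∑ i : Fin N, iteratedDeriv 2
        (fun s : ℝ => φ (p.1 + s • EuclideanSpace.single i (1 : ℝ), p.2)) 0)
      + deriv (fun τ : ℝ => |τ| * deriv (fun τ' : ℝ => φ (p.1, τ')) τ) p.2
      = halfSign p.2 * weightedLap φ p := by
  have h1 : ∀ i : Fin N, iteratedDeriv 2
      (fun s : ℝ => φ (p.1 + s • EuclideanSpace.single i (1 : ℝ), p.2)) 0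
      = dirDeriv (horizDir i) (dirDeriv (horizDir i) φ) p := fun i => by
    rw [← iteratedDeriv_two_line hφ]
    congr 1
    ext s
    congr 1
    ext <;> simp [horizDir]
  have h2 : (fun τ : ℝ => |τ| * deriv (fun τ' : ℝ => φ (p.1, τ')) τ)
      = fun τ => |τ| * dirDeriv (0, 1) φ (p.1, τ) :=
    funext fun τ => by rw [(hasDerivAt_vert hφ p.1 τ).deriv]
  have h3 : HasDerivAt (fun τ : ℝ => |τ|) (halfSign p.2) p.2 := by
    unfold halfSign
    split_ifs with h
    · exact hasDerivAt_abs_pos h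
    · exact hasDerivAt_abs_neg (lt_of_le_of_ne (not_lt.1 h) hp)
  simp only [h1]
  rw [h2, (h3.fun_mul (hasDerivAt_vert (contDiff_dirDeriv hφ _) p.1 p.2)).deriv,
    ← halfSign_mul_self, weightedLap]
  ring

end TestFunction

/-- the even-in-`t` extension `(x,t) ↦ w_u(x,|t|)` solves
`−div(|t| ∇w) = 2 u ℒ^N ⊗ δ_0` in `ℝ^{N+1}` in the distributional sense:
for every `φ ∈ C_c^∞(ℝ^{N+1})`,
`∫ w_u(x,|t|) (|t| Δ_x φ + ∂_t(|t| ∂_t φ)) dx dt = −2 ∫ u(x) φ(x,0) dx`. -/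
theorem stmt6 (N : ℕ) (hN : 1 ≤ N) (u : EuclideanSpace ℝ (Fin N) → ℝ)
    (hu : MemL10 N u)
    (φ : EuclideanSpace ℝ (Fin N) × ℝ → ℝ)
    (hφ : ContDiff ℝ (⊤ : ℕ∞) φ) (hφc : HasCompactSupport φ) :
    (∫ p : EuclideanSpace ℝ (Fin N) × ℝ,
        poissonExt N u p.1 (|p.2|) *
          (|p.2| * (∑ i : Fin N, iteratedDeriv 2
              (fun s : ℝ => φ (p.1 + s • EuclideanSpace.single i (1 : ℝ), p.2)) 0)
            + deriv (fun τ : ℝ => |τ| * deriv (fun τ' : ℝ => φ (p.1, τ')) τ) p.2))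
      = -2 * ∫ x, u x * φ (x, 0) := by
  have hne : ∀ᵐ p : EuclideanSpace ℝ (Fin N) × ℝ, p.2 ≠ 0 := by
    rw [Measure.volume_eq_prod]
    exact Measure.quasiMeasurePreserving_snd.ae (Measure.ae_ne volume 0)
  have hcN := cN_pos hN
  have hint := integrable_kernel_mul hu (continuous_weightedLap hφ)
    (hasCompactSupport_weightedLap hφc)
  calc _ = ∫ p, cN N / 2 * ∫ y, u y * (halfSign p.2 *
        (sqDist 0 (p - (y, 0)) ^ (-(N : ℝ) / 2) * weightedLap φ p)) := by
        refine integral_congr_ae (hne.mono fun p hp => ?_)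
        simp only [weightedDiv_eq hφ hp]
        rw [poissonExt, mul_assoc, ← integral_mul_const]
        congr 2 with y
        simp only [sqDist, Prod.fst_sub, Prod.snd_sub, sub_zero, add_zero, sq_abs]
        ring
    _ = cN N / 2 * ∫ y, ∫ p, u y * (halfSign p.2 *
        (sqDist 0 (p - (y, 0)) ^ (-(N : ℝ) / 2) * weightedLap φ p)) := by
        rw [integral_const_mul]
        congr 1
        exact (integral_integral_swap (f := fun y p => u y * (halfSign p.2 *
          (sqDist 0 (p - (y, 0)) ^ (-(N : ℝ) / 2) * weightedLap φ p))) hint).symm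
    _ = cN N / 2 * ∫ y, -(4 / cN N) * (u y * φ (y, 0)) := by
        congr 2 with y
        rw [integral_const_mul, integral_translated_kernel_mul_weightedLap hN hφ hφc y]
        ring
    _ = _ := by
        rw [integral_const_mul]
        field_simp
        ring
end
end
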